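/- The function x ↦ (15i·x² + 26x − 7i)/((x − i)⁵·(x + i)³), viewed as a map from ℝ to ℂ, is integrable on ℝ, and its integral over ℝ equals 55πi/16. (This is the normal-direction integral evaluated by residues in equation (3.81), yielding the coefficient 55/16·π·h'(0)·dim F·Ω₄ in case (c) of Section 3.) -/

import Mathlib

open Complex MeasureTheory

lemma ofReal_sub_I_ne_zero (x : ℝ) : (x : ℂ) - I ≠ 0 := fun h => by
  simpa using congrArg Complex.im h

lemma ofReal_add_I_ne_zero (x : ℝ) : (x : ℂ) + I ≠ 0 := fun h => by
  simpa using congrArg Complex.im h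

lemma sub_I_mul_add_I (x : ℂ) : (x - I) * (x + I) = 1 + x ^ 2 := by
  linear_combination -I_sq

lemma hasDerivAt_inv_ofReal_add (c : ℂ) (x : ℝ) (h : (x : ℂ) + c ≠ 0) :
    HasDerivAt (fun y : ℝ => ((y : ℂ) + c)⁻¹) (-(((x : ℂ) + c)⁻¹) ^ 2) x := by
  have := ((ofRealCLM.hasDerivAt (x := x)).add_const c).inv (by simpa using h)
  refine this.congr_deriv ?_
  simp [neg_div]

lemma tendsto_inv_ofReal_add (c : ℂ) {l : Filter ℝ} (hl : l ≤ Bornology.cobounded ℝ) :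
    Filter.Tendsto (fun y : ℝ => ((y : ℂ) + c)⁻¹) l (nhds 0) := by
  refine Filter.tendsto_inv₀_cobounded.comp ?_
  refine (tendsto_add_const_cobounded c).comp ?_
  refine Filter.Tendsto.mono_left ?_ hl
  rw [← tendsto_norm_atTop_iff_cobounded]
  exact tendsto_norm_cobounded_atTop.congr fun y : ℝ => (norm_real y).symm

/-- The rational part of the antiderivative, with `t = (x - i)⁻¹` and `s = (x + i)⁻¹`. -/
noncomputable def rationalPart (t s : ℂ) : ℂ :=
  t ^ 4 / 8 + 5 * I / 12 * t ^ 3 + 3 / 16 * t ^ 2 + 23 * I / 16 * t - 3 / 4 * s ^ 2 + 2 * I * s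

/-- An antiderivative on `ℝ` of the integrand, from its partial fraction decomposition. -/
noncomputable def antiderivative (x : ℝ) : ℂ :=
  rationalPart ((x : ℂ) + -I)⁻¹ ((x : ℂ) + I)⁻¹ + 55 * I / 16 * (Real.arctan x : ℂ)

lemma hasDerivAt_antiderivative (x : ℝ) :
    HasDerivAt antiderivative
      ((15 * I * (x : ℂ)^2 + 26 * (x : ℂ) - 7 * I) / (((x : ℂ) - I) ^ 5 * ((x : ℂ) + I) ^ 3)) x := by
  have h1 := ofReal_sub_I_ne_zero x
  have h2 := ofReal_add_I_ne_zero x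
  have ht := hasDerivAt_inv_ofReal_add (-I) x (by simpa [sub_eq_add_neg] using h1)
  have hs := hasDerivAt_inv_ofReal_add I x h2
  have ha := (Real.hasDerivAt_arctan x).ofReal_comp
  have := (((((((ht.pow 4).div_const 8).add ((ht.pow 3).const_mul (5 * I / 12))).add
    ((ht.pow 2).const_mul (3 / 16))).add (ht.const_mul (23 * I / 16))).sub
    ((hs.pow 2).const_mul (3 / 4))).add (hs.const_mul (2 * I))).add (ha.const_mul (55 * I / 16))
  refine this.congr_deriv ?_
  push_cast
  rw [← sub_I_mul_add_I, ← sub_eq_add_neg]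
  have hI := I_sq
  generalize (x : ℂ) = z at *
  generalize I = i at *
  field_simp
  grind

lemma tendsto_antiderivative {l : Filter ℝ} (hl : l ≤ Bornology.cobounded ℝ) {a : ℝ}
    (ha : Filter.Tendsto Real.arctan l (nhds a)) :
    Filter.Tendsto antiderivative l (nhds (55 * I / 16 * (a : ℂ))) := by
  have hc : Continuous fun p : ℂ × ℂ => rationalPart p.1 p.2 := by
    unfold rationalPart; fun_prop
  have hr := (hc.tendsto (0, 0)).comp
    ((tendsto_inv_ofReal_add (-I) hl).prodMk_nhds (tendsto_inv_ofReal_add I hl))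
  have := hr.add (((continuous_ofReal.tendsto a).comp ha).const_mul (55 * I / 16))
  have h0 : rationalPart 0 0 = 0 := by simp [rationalPart]
  rw [h0, zero_add] at this
  exact this

lemma norm_integrand_le (x : ℝ) :
    ‖(15 * I * (x : ℂ)^2 + 26 * (x : ℂ) - 7 * I) / (((x : ℂ) - I) ^ 5 * ((x : ℂ) + I) ^ 3)‖
      ≤ 28 * (1 + x ^ 2)⁻¹ := by
  have hm : ‖(x : ℂ) - I‖ = √(1 + x ^ 2) := by
    rw [norm_def, normSq_apply]; congr 1; simp; ring
  have hp : ‖(x : ℂ) + I‖ = √(1 + x ^ 2) := by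
    rw [norm_def, normSq_apply]; congr 1; simp; ring
  have hd : √(1 + x ^ 2) ^ 5 * √(1 + x ^ 2) ^ 3 = (1 + x ^ 2) ^ 4 := by
    rw [← pow_add, show 5 + 3 = 2 * 4 from rfl, pow_mul, Real.sq_sqrt (by positivity)]
  have hn : ‖15 * I * (x : ℂ)^2 + 26 * (x : ℂ) - 7 * I‖ ≤ 15 * x ^ 2 + 26 * |x| + 7 := by
    refine (norm_sub_le _ _).trans (add_le_add ((norm_add_le _ _).trans ?_) ?_) <;> simp
  rw [norm_div, norm_mul, norm_pow, norm_pow, hm, hp, hd, ← div_eq_mul_inv,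
    div_le_div_iff₀ (by positivity) (by positivity)]
  have hx : 15 * x ^ 2 + 26 * |x| + 7 ≤ 28 * (1 + x ^ 2) := by
    nlinarith [sq_nonneg (|x| - 1), sq_abs x]
  calc _ ≤ 28 * (1 + x ^ 2) * (1 + x ^ 2) := by gcongr; exact hn.trans hx
    _ = 28 * (1 + x ^ 2) ^ 2 := by ring
    _ ≤ 28 * (1 + x ^ 2) ^ 4 := by gcongr <;> nlinarith [sq_nonneg x]

lemma integrable_integrand : Integrable (fun x : ℝ =>
    (15 * I * (x : ℂ)^2 + 26 * (x : ℂ) - 7 * I) / (((x : ℂ) - I) ^ 5 * ((x : ℂ) + I) ^ 3)) := by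
  refine (integrable_inv_one_add_sq.const_mul 28).mono' ?_ (.of_forall norm_integrand_le)
  refine Continuous.aestronglyMeasurable (Continuous.div (by fun_prop) (by fun_prop) fun x => ?_)
  exact mul_ne_zero (pow_ne_zero _ (ofReal_sub_I_ne_zero x)) (pow_ne_zero _ (ofReal_add_I_ne_zero x))

theorem stmt_10 :
    MeasureTheory.Integrable
      (fun x : ℝ => (15 * I * (x : ℂ)^2 + 26 * (x : ℂ) - 7 * I) / (((x : ℂ) - I) ^ 5 * ((x : ℂ) + I) ^ 3)) ∧
    ∫ x : ℝ, (15 * I * (x : ℂ)^2 + 26 * (x : ℂ) - 7 * I) / (((x : ℂ) - I) ^ 5 * ((x : ℂ) + I) ^ 3) = 55 * (Real.pi : ℂ) * I / 16 := by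
  refine ⟨integrable_integrand, ?_⟩
  rw [integral_of_hasDerivAt_of_tendsto hasDerivAt_antiderivative integrable_integrand
    (tendsto_antiderivative IsOrderBornology.atBot_le_cobounded
      (Real.tendsto_arctan_atBot.mono_right nhdsWithin_le_nhds))
    (tendsto_antiderivative IsOrderBornology.atTop_le_cobounded
      (Real.tendsto_arctan_atTop.mono_right nhdsWithin_le_nhds))]
  push_cast
  ring
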